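/- arXiv:1812.04426 — 4 statements merged into one kernel-verified Lean document; each statement's English description precedes it below -/
import Mathlib

section
/- Let q : ℤ² → ℝ be a finitely supported filter having sum rules of order α = (α₁,α₂) ∈ ℕ². Then for every infinitely differentiable function F : ℝ² → ℝ and every x ∈ ℝ², as ε → 0⁺ one has ε^{-(α₁+α₂)} · Σ_{k∈ℤ²} q[k] · F(x + εk) = C_α · (∂^{α₁+α₂} F / ∂x₁^{α₁} ∂x₂^{α₂})(x) + O(ε), where C_α = (1/(α₁!·α₂!)) · Σ_{k∈ℤ²} k₁^{α₁} k₂^{α₂} q[k]. -/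
open Topology Asymptotics Finset

/-- Partial derivative with respect to the first variable. -/
noncomputable def pd1 (f : ℝ × ℝ → ℝ) : ℝ × ℝ → ℝ :=
  fun p => deriv (fun s => f (s, p.2)) p.1

/-- Partial derivative with respect to the second variable. -/
noncomputable def pd2 (f : ℝ × ℝ → ℝ) : ℝ × ℝ → ℝ :=
  fun p => deriv (fun s => f (p.1, s)) p.2

theorem pd1_eq_fderiv {G : ℝ × ℝ → ℝ} (hG : Differentiable ℝ G) :
    pd1 G = fun p => fderiv ℝ G p (1, 0) := by
  funext p
  have h : HasDerivAt (fun s : ℝ => (s, p.2)) ((1 : ℝ), (0 : ℝ)) p.1 :=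
    (hasDerivAt_id p.1).prodMk (hasDerivAt_const p.1 p.2)
  exact ((hG p).hasFDerivAt.comp_hasDerivAt p.1 h).deriv

theorem pd2_eq_fderiv {G : ℝ × ℝ → ℝ} (hG : Differentiable ℝ G) :
    pd2 G = fun p => fderiv ℝ G p (0, 1) := by
  funext p
  have h : HasDerivAt (fun s : ℝ => (p.1, s)) ((0 : ℝ), (1 : ℝ)) p.2 :=
    (hasDerivAt_const p.2 p.1).prodMk (hasDerivAt_id p.2)
  exact ((hG p).hasFDerivAt.comp_hasDerivAt p.2 h).deriv

theorem contDiff_fderiv_apply_const {G : ℝ × ℝ → ℝ} (hG : ContDiff ℝ (⊤ : ℕ∞) G) (v : ℝ × ℝ) :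
    ContDiff ℝ (⊤ : ℕ∞) fun p => fderiv ℝ G p v :=
  (hG.fderiv_right (by simp)).clm_apply contDiff_const

theorem ContDiff.pd1 {G : ℝ × ℝ → ℝ} (hG : ContDiff ℝ (⊤ : ℕ∞) G) :
    ContDiff ℝ (⊤ : ℕ∞) (pd1 G) := by
  rw [pd1_eq_fderiv (hG.differentiable (by simp))]
  exact contDiff_fderiv_apply_const hG _

theorem ContDiff.pd2 {G : ℝ × ℝ → ℝ} (hG : ContDiff ℝ (⊤ : ℕ∞) G) :
    ContDiff ℝ (⊤ : ℕ∞) (pd2 G) := by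
  rw [pd2_eq_fderiv (hG.differentiable (by simp))]
  exact contDiff_fderiv_apply_const hG _

theorem pd1_pd2_comm {G : ℝ × ℝ → ℝ} (hG : ContDiff ℝ (⊤ : ℕ∞) G) :
    pd1 (pd2 G) = pd2 (pd1 G) := by
  have hd : Differentiable ℝ G := hG.differentiable (by simp)
  have hd' : Differentiable ℝ (fderiv ℝ G) :=
    (hG.fderiv_right (m := (⊤ : ℕ∞)) (by simp)).differentiable (by simp)
  rw [pd1_eq_fderiv (hG.pd2.differentiable (by simp)),
    pd2_eq_fderiv (hG.pd1.differentiable (by simp)), pd1_eq_fderiv hd, pd2_eq_fderiv hd]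
  funext p
  have hsymm : IsSymmSndFDerivAt ℝ G p := hG.contDiffAt.isSymmSndFDerivAt <| by
    rw [minSmoothness_of_isRCLikeNormedField]
    exact WithTop.coe_le_coe.2 (le_top : (2 : ℕ∞) ≤ ⊤)
  rw [fderiv_clm_apply (hd' p) (differentiableAt_const _),
    fderiv_clm_apply (hd' p) (differentiableAt_const _)]
  simpa using hsymm.eq (1, 0) (0, 1)

theorem pd2_iterate_pd1 {G : ℝ × ℝ → ℝ} (hG : ContDiff ℝ (⊤ : ℕ∞) G) (j : ℕ) :
    pd2^[j] (pd1 G) = pd1 (pd2^[j] G) := by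
  induction j generalizing G with
  | zero => rfl
  | succ j ih => rw [Function.iterate_succ_apply, ← pd1_pd2_comm hG, ih hG.pd2,
      Function.iterate_succ_apply]

theorem contDiff_comp_line {G : ℝ × ℝ → ℝ} (hG : ContDiff ℝ (⊤ : ℕ∞) G) (x v : ℝ × ℝ) :
    ContDiff ℝ (⊤ : ℕ∞) fun t : ℝ => G (x.1 + t * v.1, x.2 + t * v.2) :=
  hG.comp (by fun_prop)

theorem deriv_comp_line {G : ℝ × ℝ → ℝ} (hG : ContDiff ℝ (⊤ : ℕ∞) G) (x v : ℝ × ℝ) :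
    deriv (fun t : ℝ => G (x.1 + t * v.1, x.2 + t * v.2)) =
      (fun t : ℝ => v.1 * pd1 G (x.1 + t * v.1, x.2 + t * v.2)) +
        fun t : ℝ => v.2 * pd2 G (x.1 + t * v.1, x.2 + t * v.2) := by
  have hd : Differentiable ℝ G := hG.differentiable (by simp)
  funext t
  have h : HasDerivAt (fun t : ℝ => (x.1 + t * v.1, x.2 + t * v.2)) (v.1, v.2) t := by
    simpa using (((hasDerivAt_id t).mul_const v.1).const_add x.1).prodMk
      (((hasDerivAt_id t).mul_const v.2).const_add x.2)
  refine ((hd _).hasFDerivAt.comp_hasDerivAt t h).deriv.trans ?_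
  rw [Pi.add_apply, pd1_eq_fderiv hd,
    pd2_eq_fderiv hd, ← smul_eq_mul v.1, ← smul_eq_mul v.2, ← map_smul, ← map_smul, ← map_add]
  simp

/-- The iterated derivatives of a smooth function along a line, expanded in partial derivatives. -/
theorem iteratedDeriv_comp_line {G : ℝ × ℝ → ℝ} (hG : ContDiff ℝ (⊤ : ℕ∞) G) (x v : ℝ × ℝ)
    (n : ℕ) (t : ℝ) :
    iteratedDeriv n (fun t : ℝ => G (x.1 + t * v.1, x.2 + t * v.2)) t =
      ∑ ij ∈ antidiagonal n, (n.choose ij.1 : ℝ) * (v.1 ^ ij.1 * v.2 ^ ij.2 *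
        (pd1^[ij.1] (pd2^[ij.2] G)) (x.1 + t * v.1, x.2 + t * v.2)) := by
  induction n generalizing G with
  | zero => simp
  | succ n ih =>
    have h1 := (contDiff_comp_line hG.pd1 x v).of_le (m := n) (by exact_mod_cast le_top)
    have h2 := (contDiff_comp_line hG.pd2 x v).of_le (m := n) (by exact_mod_cast le_top)
    rw [iteratedDeriv_succ', deriv_comp_line hG,
      iteratedDeriv_add (contDiff_const.mul h1).contDiffAt (contDiff_const.mul h2).contDiffAt,
      iteratedDeriv_const_mul_field, iteratedDeriv_const_mul_field, ih hG.pd1, ih hG.pd2,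
      Finset.sum_antidiagonal_choose_succ_mul (fun i j => v.1 ^ i * v.2 ^ j *
        (pd1^[i] (pd2^[j] G)) (x.1 + t * v.1, x.2 + t * v.2)), add_comm, mul_sum, mul_sum]
    congr 1
    · refine sum_congr rfl fun ij _ => ?_
      rw [Function.iterate_succ_apply]
      ring
    · refine sum_congr rfl fun ij hij => ?_
      rw [pd2_iterate_pd1 hG, Function.iterate_succ_apply,
        Nat.choose_symm_of_eq_add (mem_antidiagonal.1 hij).symm]
      ring

/-- Taylor's theorem at `0` from the right, with a big-O remainder. -/
theorem taylor_isBigO_nhdsGT_zero {g : ℝ → ℝ} (hg : ContDiff ℝ (⊤ : ℕ∞) g) (n : ℕ) :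
    (fun t => g t - ∑ m ∈ range (n + 1), t ^ m / m.factorial * iteratedDeriv m g 0)
      =O[𝓝[>] (0 : ℝ)] fun t => t ^ (n + 1) := by
  obtain ⟨C, hC⟩ := exists_taylor_mean_remainder_bound (f := g) (n := n) (zero_le_one' ℝ)
    (hg.of_le (by exact_mod_cast le_top)).contDiffOn
  refine IsBigO.of_bound C ?_
  filter_upwards [Ioc_mem_nhdsGT (zero_lt_one' ℝ)] with t ht
  have key := hC t (Set.Ioc_subset_Icc_self ht)
  rw [taylor_within_apply, sub_zero] at key
  rw [Real.norm_of_nonneg (pow_nonneg ht.1.le (n + 1))]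
  refine le_trans (le_of_eq (congrArg (fun y => ‖g t - y‖) ?_)) key
  refine sum_congr rfl fun m _ => ?_
  rw [iteratedDerivWithin_eq_iteratedDeriv (uniqueDiffOn_Icc zero_lt_one)
    (hg.of_le (by exact_mod_cast le_top)).contDiffAt (by simp), smul_eq_mul]
  ring

/-- Correlating a filter having sum rules with the iterated derivatives along lines isolates a
single partial derivative. -/
theorem sum_mul_iteratedDeriv_comp_line_of_sum_rules
    (q : (ℤ × ℤ) →₀ ℝ) (α : ℕ × ℕ)
    (hsum : ∀ β : ℕ × ℕ,
      (β.1 + β.2 < α.1 + α.2 ∨ (β.1 + β.2 = α.1 + α.2 ∧ β ≠ α)) →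
      ∑ k ∈ q.support, ((k.1 : ℝ) ^ β.1 * (k.2 : ℝ) ^ β.2) * q k = 0)
    {F : ℝ × ℝ → ℝ} (hF : ContDiff ℝ (⊤ : ℕ∞) F) (x : ℝ × ℝ) {m : ℕ} (hm : m ≤ α.1 + α.2) :
    ∑ k ∈ q.support, q k *
        iteratedDeriv m (fun t : ℝ => F (x.1 + t * (k.1 : ℝ), x.2 + t * (k.2 : ℝ))) 0 =
      if m = α.1 + α.2 then ((α.1 + α.2).choose α.1 : ℝ) *
        (∑ k ∈ q.support, ((k.1 : ℝ) ^ α.1 * (k.2 : ℝ) ^ α.2) * q k) *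
          (pd1^[α.1] (pd2^[α.2] F)) x
      else 0 := by
  have expand : ∑ k ∈ q.support, q k *
        iteratedDeriv m (fun t : ℝ => F (x.1 + t * (k.1 : ℝ), x.2 + t * (k.2 : ℝ))) 0 =
      ∑ ij ∈ antidiagonal m, (m.choose ij.1 : ℝ) *
        (∑ k ∈ q.support, ((k.1 : ℝ) ^ ij.1 * (k.2 : ℝ) ^ ij.2) * q k) *
          (pd1^[ij.1] (pd2^[ij.2] F)) x := by
    simp_rw [mul_sum, sum_mul]
    rw [sum_comm]
    refine sum_congr rfl fun k _ => ?_
    rw [iteratedDeriv_comp_line hF x ((k.1 : ℝ), (k.2 : ℝ)), mul_sum]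
    refine sum_congr rfl fun ij _ => ?_
    simp only [zero_mul, add_zero]
    ring
  rw [expand]
  split_ifs with h
  · subst h
    refine sum_eq_single_of_mem α (by simp) fun ij hij hne => ?_
    rw [hsum ij (Or.inr ⟨mem_antidiagonal.1 hij, hne⟩), mul_zero, zero_mul]
  · refine sum_eq_zero fun ij hij => ?_
    rw [hsum ij (Or.inl ((mem_antidiagonal.1 hij).trans_lt (lt_of_le_of_ne hm h))), mul_zero,
      zero_mul]

/-- If a finitely supported filter `q : ℤ² → ℝ` has sum rules of order `α = (α₁, α₂)`,
then for every smooth `F : ℝ² → ℝ` and every `x`, as `ε → 0⁺`,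
`ε^{-|α|} ∑_k q[k] F(x + εk) = C_α ∂^α F(x) + O(ε)` where
`C_α = (1/(α₁!α₂!)) ∑_k k₁^{α₁} k₂^{α₂} q[k]`. -/
theorem sum_rules_filter_approximates_derivative
    (q : (ℤ × ℤ) →₀ ℝ) (α : ℕ × ℕ)
    (hsum : ∀ β : ℕ × ℕ,
      (β.1 + β.2 < α.1 + α.2 ∨ (β.1 + β.2 = α.1 + α.2 ∧ β ≠ α)) →
      ∑ k ∈ q.support, ((k.1 : ℝ) ^ β.1 * (k.2 : ℝ) ^ β.2) * q k = 0)
    (F : ℝ × ℝ → ℝ) (hF : ContDiff ℝ (⊤ : ℕ∞) F) (x : ℝ × ℝ) :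
    (fun ε : ℝ =>
      (∑ k ∈ q.support, q k * F (x.1 + ε * (k.1 : ℝ), x.2 + ε * (k.2 : ℝ))) / ε ^ (α.1 + α.2)
        - ((1 / ((α.1.factorial : ℝ) * (α.2.factorial : ℝ))) *
            ∑ k ∈ q.support, ((k.1 : ℝ) ^ α.1 * (k.2 : ℝ) ^ α.2) * q k) *
          (pd1^[α.1] (pd2^[α.2] F)) x)
    =O[𝓝[>] (0 : ℝ)] (fun ε => ε) := by
  set N := α.1 + α.2 with hN
  set P := ((1 / ((α.1.factorial : ℝ) * (α.2.factorial : ℝ))) *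
    ∑ k ∈ q.support, ((k.1 : ℝ) ^ α.1 * (k.2 : ℝ) ^ α.2) * q k) * (pd1^[α.1] (pd2^[α.2] F)) x
    with hP
  have hchoose : (N.choose α.1 : ℝ) / N.factorial =
      1 / ((α.1.factorial : ℝ) * (α.2.factorial : ℝ)) := by
    have h : (N.choose α.1 : ℝ) * α.1.factorial * α.2.factorial = N.factorial := by
      rw [hN, Nat.choose_symm_add]
      exact_mod_cast Nat.add_choose_mul_factorial_mul_factorial α.1 α.2
    rw [div_eq_div_iff (by positivity) (by positivity), ← h]
    ring
  have main : ∀ ε : ℝ, ∑ k ∈ q.support, q k *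
      ((fun t : ℝ => F (x.1 + t * (k.1 : ℝ), x.2 + t * (k.2 : ℝ))) ε -
        ∑ m ∈ range (N + 1), ε ^ m / m.factorial *
          iteratedDeriv m (fun t : ℝ => F (x.1 + t * (k.1 : ℝ), x.2 + t * (k.2 : ℝ))) 0) =
      (∑ k ∈ q.support, q k * F (x.1 + ε * (k.1 : ℝ), x.2 + ε * (k.2 : ℝ))) - ε ^ N * P := by
    intro ε
    simp_rw [mul_sub, sum_sub_distrib, mul_sum]
    rw [sum_comm]
    congr 1
    simp_rw [mul_left_comm (q _), ← mul_sum]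
    rw [sum_congr rfl fun m hm => by
      rw [sum_mul_iteratedDeriv_comp_line_of_sum_rules q α hsum hF x
        (Nat.lt_succ_iff.1 (mem_range.1 hm))]]
    simp only [← hN, mul_ite, mul_zero, sum_ite_eq', mem_range, Nat.lt_succ_self, if_true]
    rw [hP, ← hchoose]
    ring
  have hO : (fun ε : ℝ =>
      (∑ k ∈ q.support, q k * F (x.1 + ε * (k.1 : ℝ), x.2 + ε * (k.2 : ℝ))) - ε ^ N * P)
      =O[𝓝[>] (0 : ℝ)] fun ε => ε ^ (N + 1) := by
    simp_rw [← main]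
    exact IsBigO.fun_sum fun k _ => (taylor_isBigO_nhdsGT_zero
      (contDiff_comp_line hF x ((k.1 : ℝ), (k.2 : ℝ))) N).const_mul_left (q k)
  refine (hO.mul (isBigO_refl (fun ε : ℝ => (ε ^ N)⁻¹) _)).congr' ?_ ?_
  · filter_upwards [self_mem_nhdsWithin] with ε hε
    have hε0 : ε ≠ 0 := ne_of_gt hε
    field_simp
  · filter_upwards [self_mem_nhdsWithin] with ε hε
    have hε0 : ε ≠ 0 := ne_of_gt hε
    rw [pow_succ', mul_assoc, mul_inv_cancel₀ (pow_ne_zero N hε0), mul_one]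
end

section
/- For every polynomial P ∈ 𝒫^k[x₁,…,x_m] there exists a choice of parameters W¹,b¹,…,W^k,b^k,W^{k+1},b^{k+1} of the network SymNet_m^k such that SymNet_m^k(x₁,…,x_m) = P(x₁,…,x_m) for all (x₁,…,x_m) ∈ ℝ^m. -/
open Finset

/-- The total number of multiplications of a polynomial written as a sum of distinct
monomials: the sum over its monomials of `max(deg − 1, 0)` (here natural subtraction),
where `deg` is the total degree of the monomial. -/
def multCount {σ : Type*} (P : MvPolynomial σ ℝ) : ℕ :=
  ∑ d ∈ P.support, ((d.sum fun _ e => e) - 1)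

/-- The hidden-layer state `z^k` of `SymNet_m^k`:
`z⁰ = x`, and `z^{i+1} = (z^i, η_{i+1}·ξ_{i+1})` where
`(η_{i+1}, ξ_{i+1})ᵀ = W^{i+1} z^i + b^{i+1}`. -/
def symNetZ (m : ℕ) (W : (i : ℕ) → Matrix (Fin 2) (Fin (m + i)) ℝ)
    (b : ℕ → Fin 2 → ℝ) (x : Fin m → ℝ) : (k : ℕ) → Fin (m + k) → ℝ
  | 0 => x
  | k + 1 =>
    let z := symNetZ m W b x k
    Fin.snoc z (((W k).mulVec z 0 + b k 0) * ((W k).mulVec z 1 + b k 1))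

/-- The symbolic network `SymNet_m^k`: the output is `W^{k+1} z^k + b^{k+1}`. -/
def symNet (m k : ℕ) (W : (i : ℕ) → Matrix (Fin 2) (Fin (m + i)) ℝ)
    (b : ℕ → Fin 2 → ℝ) (Wlast : Fin (m + k) → ℝ) (blast : ℝ)
    (x : Fin m → ℝ) : ℝ :=
  (∑ j, Wlast j * symNetZ m W b x k j) + blast

/-- The real functions of the input that are affine in the hidden-layer state `z^n`. -/
def symNetAffine (m : ℕ) (W : (i : ℕ) → Matrix (Fin 2) (Fin (m + i)) ℝ)
    (b : ℕ → Fin 2 → ℝ) (n : ℕ) : Submodule ℝ ((Fin m → ℝ) → ℝ) where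
  carrier := {f | ∃ (w : Fin (m + n) → ℝ) (c : ℝ),
    ∀ x, f x = (∑ j, w j * symNetZ m W b x n j) + c}
  zero_mem' := ⟨0, 0, by simp⟩
  add_mem' := by
    rintro f g ⟨w, c, hf⟩ ⟨v, d, hg⟩
    refine ⟨w + v, c + d, fun x => ?_⟩
    simp only [Pi.add_apply, hf, hg, add_mul, sum_add_distrib]
    ring
  smul_mem' := by
    rintro a f ⟨w, c, hf⟩
    refine ⟨a • w, a * c, fun x => ?_⟩
    simp only [Pi.smul_apply, smul_eq_mul, hf, mul_assoc, mul_add, mul_sum]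

section

variable {m : ℕ} {W W' : (i : ℕ) → Matrix (Fin 2) (Fin (m + i)) ℝ} {b b' : ℕ → Fin 2 → ℝ}

theorem mem_symNetAffine {n : ℕ} {f : (Fin m → ℝ) → ℝ} :
    f ∈ symNetAffine m W b n ↔ ∃ (w : Fin (m + n) → ℝ) (c : ℝ),
      ∀ x, f x = (∑ j, w j * symNetZ m W b x n j) + c :=
  Iff.rfl

/-- The state `z^n` depends only on the first `n` layers of parameters. -/
theorem symNetZ_congr {n : ℕ} (hW : ∀ i < n, W i = W' i) (hb : ∀ i < n, b i = b' i)
    (x : Fin m → ℝ) : symNetZ m W b x n = symNetZ m W' b' x n := by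
  induction n with
  | zero => rfl
  | succ n ih =>
    simp only [symNetZ, ih (fun i hi => hW i (by omega)) (fun i hi => hb i (by omega)),
      hW n (by omega), hb n (by omega)]

theorem symNetAffine_congr {n : ℕ} (hW : ∀ i < n, W i = W' i) (hb : ∀ i < n, b i = b' i) :
    symNetAffine m W b n = symNetAffine m W' b' n := by
  ext f
  simp only [mem_symNetAffine, symNetZ_congr hW hb]

theorem symNetAffine_mono : Monotone (symNetAffine m W b) := by
  refine monotone_nat_of_le_succ fun n => ?_
  rintro f ⟨w, c, hf⟩
  refine ⟨Fin.snoc (α := fun _ => ℝ) w 0, c, fun x => ?_⟩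
  rw [hf]
  congr 1
  refine Eq.trans ?_ (Fin.sum_univ_castSucc (n := m + n) _).symm
  simp [symNetZ]

theorem one_mem_symNetAffine (n : ℕ) : (fun _ => 1) ∈ symNetAffine m W b n :=
  ⟨0, 1, by simp⟩

theorem coord_mem_symNetAffine (n : ℕ) (i : Fin m) :
    (fun x => x i) ∈ symNetAffine m W b n := by
  refine symNetAffine_mono (Nat.zero_le n) ⟨Pi.single i 1, 0, fun x => ?_⟩
  simp [symNetZ, Pi.single_apply]

/-- One more hidden layer suffices to form the product of two available functions. -/
theorem exists_mul_mem_symNetAffine {n : ℕ} {f g : (Fin m → ℝ) → ℝ}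
    (hf : f ∈ symNetAffine m W b n) (hg : g ∈ symNetAffine m W b n) :
    ∃ W' b', symNetAffine m W b n ≤ symNetAffine m W' b' (n + 1) ∧
      (fun x => f x * g x) ∈ symNetAffine m W' b' (n + 1) := by
  obtain ⟨w, c, hf⟩ := hf
  obtain ⟨v, d, hg⟩ := hg
  let W' := Function.update W n (Matrix.of ![w, v])
  let b' := Function.update b n ![c, d]
  have hW : ∀ i < n, W i = W' i := fun i hi => (Function.update_of_ne hi.ne _ _).symm
  have hb : ∀ i < n, b i = b' i := fun i hi => (Function.update_of_ne hi.ne _ _).symm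
  refine ⟨W', b', ?_, ?_⟩
  · rw [symNetAffine_congr hW hb]
    exact symNetAffine_mono n.le_succ
  · refine ⟨Pi.single (Fin.last (m + n)) 1, 0, fun x => ?_⟩
    simp only [hf, hg, symNetZ_congr hW hb]
    refine Eq.trans ?_ (congrArg (· + (0 : ℝ)) (Fin.sum_univ_castSucc (n := m + n) _).symm)
    simp [symNetZ, W', b', Matrix.mulVec, dotProduct, (Fin.castSucc_lt_last _).ne]

theorem exists_list_prod_mem_symNetAffine (W : (i : ℕ) → Matrix (Fin 2) (Fin (m + i)) ℝ)
    (b : ℕ → Fin 2 → ℝ) (n : ℕ) (l : List (Fin m)) :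
    ∃ W' b', symNetAffine m W b n ≤ symNetAffine m W' b' (n + (l.length - 1)) ∧
      (fun x => (l.map x).prod) ∈ symNetAffine m W' b' (n + (l.length - 1)) := by
  induction l with
  | nil => exact ⟨W, b, le_rfl, by simpa using one_mem_symNetAffine n⟩
  | cons i l ih =>
    cases l with
    | nil => exact ⟨W, b, le_rfl, by simpa using coord_mem_symNetAffine n i⟩
    | cons j l =>
      obtain ⟨W₁, b₁, hle, hmem⟩ := ih
      obtain ⟨W₂, b₂, hle', hmem'⟩ :=
        exists_mul_mem_symNetAffine (coord_mem_symNetAffine _ i) hmem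
      exact ⟨W₂, b₂, hle.trans hle', by simpa [add_assoc] using hmem'⟩

theorem exists_monomials_mem_symNetAffine (s : Finset (Fin m →₀ ℕ)) :
    ∃ (W : (i : ℕ) → Matrix (Fin 2) (Fin (m + i)) ℝ) (b : ℕ → Fin 2 → ℝ),
      ∀ d ∈ s, (fun x => d.prod fun i e => x i ^ e) ∈
        symNetAffine m W b (∑ d ∈ s, ((d.sum fun _ e => e) - 1)) := by
  induction s using Finset.induction_on with
  | empty => exact ⟨0, 0, by simp⟩
  | insert d s hd ih =>
    obtain ⟨W, b, h⟩ := ih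
    obtain ⟨W', b', hle, hmem⟩ := exists_list_prod_mem_symNetAffine W b
      (∑ d ∈ s, ((d.sum fun _ e => e) - 1)) d.toMultiset.toList
    have hlen : d.toMultiset.toList.length = d.sum fun _ e => e := by
      rw [Multiset.length_toList, Finsupp.card_toMultiset]
      rfl
    have hprod (x : Fin m → ℝ) :
        (d.toMultiset.toList.map x).prod = d.prod fun i e => x i ^ e := by
      rw [Multiset.prod_map_toList, Finsupp.toMultiset_map, Finsupp.prod_toMultiset,
        Finsupp.prod_mapDomain_index (by simp) (by simp [pow_add])]
    simp only [hlen, hprod] at hle hmem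
    refine ⟨W', b', ?_⟩
    rw [sum_insert hd, add_comm, forall_mem_insert]
    exact ⟨hmem, fun e he => hle (h e he)⟩

end

/-- For every polynomial `P ∈ 𝒫^k[x₁,…,x_m]` (total number of multiplications at most
`k`), there is a choice of parameters of `SymNet_m^k` so that the network computes `P`. -/
theorem symNet_represents_polynomials (m k : ℕ) (P : MvPolynomial (Fin m) ℝ)
    (hP : multCount P ≤ k) :
    ∃ (W : (i : ℕ) → Matrix (Fin 2) (Fin (m + i)) ℝ) (b : ℕ → Fin 2 → ℝ)
      (Wlast : Fin (m + k) → ℝ) (blast : ℝ),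
      ∀ x : Fin m → ℝ, symNet m k W b Wlast blast x = MvPolynomial.eval x P := by
  obtain ⟨W, b, h⟩ := exists_monomials_mem_symNetAffine P.support
  have hmem : (fun x => MvPolynomial.eval x P) ∈ symNetAffine m W b k := by
    have hsum : (fun x => MvPolynomial.eval x P) =
        ∑ d ∈ P.support, P.coeff d • fun x : Fin m → ℝ => d.prod fun i e => x i ^ e := by
      ext x
      simp [MvPolynomial.eval_eq, Finsupp.prod]
    rw [hsum]
    exact sum_mem fun d hd => Submodule.smul_mem _ _ (symNetAffine_mono hP (h d hd))
  obtain ⟨w, c, hw⟩ := hmem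
  exact ⟨W, b, w, c, fun x => (hw x).symm⟩
end

section
/- Let P ∈ 𝒫^{k+1}[x₁,…,x_m] be a polynomial containing at least one monomial of total degree at least 2, and suppose that monomial is divisible by x_a·x_b for some indices a,b ∈ {1,…,m}. Then there exists a polynomial Q ∈ 𝒫^k[x₁,…,x_m,y] in m+1 variables such that P(x₁,…,x_m) = Q(x₁,…,x_m, x_a·x_b) identically on ℝ^m. -/
open Finset

theorem multCount_le_of_support_subset {σ : Type*} {P : MvPolynomial σ ℝ}
    {s : Finset (σ →₀ ℕ)} (h : P.support ⊆ s) :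
    multCount P ≤ ∑ d ∈ s, ((d.sum fun _ e => e) - 1) :=
  Finset.sum_le_sum_of_subset h

theorem multCount_add_le {σ : Type*} (P Q : MvPolynomial σ ℝ) :
    multCount (P + Q) ≤ multCount P + multCount Q := by
  classical
  refine (multCount_le_of_support_subset MvPolynomial.support_add).trans ?_
  rw [multCount, multCount, ← Finset.sum_union_inter]
  exact Nat.le_add_right _ _

theorem multCount_monomial_le {σ : Type*} (d : σ →₀ ℕ) (c : ℝ) :
    multCount (MvPolynomial.monomial d c) ≤ (d.sum fun _ e => e) - 1 := by
  refine (multCount_le_of_support_subset MvPolynomial.support_monomial_subset).trans ?_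
  rw [Finset.sum_singleton]

theorem multCount_rename {σ τ : Type*} {f : σ → τ} (hf : Function.Injective f)
    (P : MvPolynomial σ ℝ) : multCount (MvPolynomial.rename f P) = multCount P := by
  classical
  rw [multCount, MvPolynomial.support_rename_of_injective hf,
    Finset.sum_image (Finsupp.mapDomain_injective hf).injOn, multCount]
  refine Finset.sum_congr rfl fun d _ => ?_
  rw [Finsupp.sum_mapDomain_index (fun _ => rfl) (fun _ _ _ => rfl)]

theorem multCount_sub_monomial_add_le {σ : Type*} (P : MvPolynomial σ ℝ) {d : σ →₀ ℕ}
    (hd : d ∈ P.support) :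
    multCount (P - MvPolynomial.monomial d (P.coeff d)) + ((d.sum fun _ e => e) - 1) ≤
      multCount P := by
  classical
  have h : (P - MvPolynomial.monomial d (P.coeff d)).support ⊆ P.support.erase d := by
    intro e he
    rw [MvPolynomial.mem_support_iff, MvPolynomial.coeff_sub, MvPolynomial.coeff_monomial] at he
    rw [Finset.mem_erase, MvPolynomial.mem_support_iff]
    by_cases hde : d = e
    · simp [hde] at he
    · exact ⟨Ne.symm hde, by simpa [hde] using he⟩
  refine (Nat.add_le_add_right (multCount_le_of_support_subset h) _).trans ?_
  rw [Finset.sum_erase_add _ _ hd, multCount]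

/-- If `P ∈ 𝒫^{k+1}[x₁,…,x_m]` contains a monomial of total degree at least `2` which is
divisible by `x_a · x_b`, then there is `Q ∈ 𝒫^k[x₁,…,x_m,y]` in `m+1` variables with
`P(x₁,…,x_m) = Q(x₁,…,x_m, x_a·x_b)` identically on `ℝ^m`. -/
theorem substitute_product_reduces_multCount
    (m k : ℕ) (P : MvPolynomial (Fin m) ℝ) (a b : Fin m)
    (hP : multCount P ≤ k + 1)
    (d : Fin m →₀ ℕ) (hd : d ∈ P.support)
    (hdeg : 2 ≤ d.sum fun _ e => e)
    (hdiv : Finsupp.single a 1 + Finsupp.single b 1 ≤ d) :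
    ∃ Q : MvPolynomial (Fin (m + 1)) ℝ, multCount Q ≤ k ∧
      ∀ x : Fin m → ℝ,
        MvPolynomial.eval x P = MvPolynomial.eval (Fin.snoc x (x a * x b)) Q := by
  obtain ⟨r, rfl⟩ := exists_add_of_le hdiv
  set d := Finsupp.single a 1 + Finsupp.single b 1 + r with hd_def
  set e : Fin (m + 1) →₀ ℕ :=
    Finsupp.mapDomain Fin.castSucc r + Finsupp.single (Fin.last m) 1 with he_def
  have hinj : Function.Injective (Fin.castSucc : Fin m → Fin (m + 1)) :=
    Fin.castSucc_injective m
  have hd_sum : (d.sum fun _ n => n) = (r.sum fun _ n => n) + 2 := by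
    rw [hd_def, Finsupp.sum_add_index' (fun _ => rfl) (fun _ _ _ => rfl),
      Finsupp.sum_add_index' (fun _ => rfl) (fun _ _ _ => rfl),
      Finsupp.sum_single_index rfl, Finsupp.sum_single_index rfl]
    ring
  have he_sum : (e.sum fun _ n => n) = (r.sum fun _ n => n) + 1 := by
    rw [he_def, Finsupp.sum_add_index' (fun _ => rfl) (fun _ _ _ => rfl),
      Finsupp.sum_mapDomain_index (fun _ => rfl) (fun _ _ _ => rfl),
      Finsupp.sum_single_index rfl]
  refine ⟨MvPolynomial.rename Fin.castSucc (P - MvPolynomial.monomial d (P.coeff d)) +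
    MvPolynomial.monomial e (P.coeff d), ?_, fun x => ?_⟩
  · have hadd := multCount_add_le
      (MvPolynomial.rename Fin.castSucc (P - MvPolynomial.monomial d (P.coeff d)))
      (MvPolynomial.monomial e (P.coeff d))
    rw [multCount_rename hinj] at hadd
    have hsub := multCount_sub_monomial_add_le P hd
    have hmon := multCount_monomial_le e (P.coeff d)
    omega
  · have hcomp : (Fin.snoc x (x a * x b) : Fin (m + 1) → ℝ) ∘ Fin.castSucc = x := by
      funext i
      simp
    have hmon : MvPolynomial.eval (Fin.snoc x (x a * x b) : Fin (m + 1) → ℝ)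
        (MvPolynomial.monomial e (P.coeff d)) =
        MvPolynomial.eval x (MvPolynomial.monomial d (P.coeff d)) := by
      rw [he_def, hd_def, MvPolynomial.eval_monomial, MvPolynomial.eval_monomial]
      simp only [Finsupp.prod_add_index' (fun _ => pow_zero _) (fun _ _ _ => pow_add _ _ _),
        Finsupp.prod_mapDomain_index (fun _ => pow_zero _) (fun _ _ _ => pow_add _ _ _),
        Finsupp.prod_single_index, pow_zero, pow_one, Fin.snoc_castSucc, Fin.snoc_last]
      ring
    rw [map_add, hmon, MvPolynomial.eval_rename, hcomp, map_sub, sub_add_cancel]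
end

section
/- Let q be a 3×3 filter with entries q[k₁,k₂] ∈ ℝ, k₁,k₂ ∈ {-1,0,1}, whose moments satisfy m_{0,0} = 0, m_{0,1} = 0, m_{0,2} = 0, m_{1,0} = 1, m_{1,1} = 0 and m_{2,0} = 0 (the remaining moments being arbitrary). Then for every infinitely differentiable function f : ℝ² → ℝ and every (x,y) ∈ ℝ², as ε → 0⁺ one has (1/ε) · Σ_{k₁,k₂=-1}^{1} q[k₁,k₂] · f(x + k₁ε, y + k₂ε) = (∂f/∂x)(x,y) + O(ε²). -/
open Topology Asymptotics Finset

/-- The `(i,j)`-moment of a `3×3` filter `q` with indices `k₁,k₂ ∈ {-1,0,1}`: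
`m_{i,j} = (1/(i!j!)) ∑_{k₁,k₂=-1}^{1} k₁^i k₂^j q[k₁,k₂]`. -/
noncomputable def moment3 (q : ℤ → ℤ → ℝ) (i j : ℕ) : ℝ :=
  (1 / ((i.factorial : ℝ) * (j.factorial : ℝ))) *
    ∑ k₁ ∈ Finset.Icc (-1 : ℤ) 1, ∑ k₂ ∈ Finset.Icc (-1 : ℤ) 1,
      (k₁ : ℝ) ^ i * (k₂ : ℝ) ^ j * q k₁ k₂

/-- Second-order Taylor expansion of a smooth function along a line. -/
theorem ContDiff.isBigO_sub_taylor_two_along_line {E : Type*} [NormedAddCommGroup E]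
    [NormedSpace ℝ E] {f : E → ℝ} (hf : ContDiff ℝ 3 f) (p v : E) :
    (fun ε : ℝ => f (p + ε • v) -
        (f p + ε * fderiv ℝ f p v + ε ^ 2 / 2 * fderiv ℝ (fderiv ℝ f) p v v))
      =O[𝓝 0] fun ε => ε ^ 3 := by
  have hline (t : ℝ) : HasDerivAt (fun s : ℝ => p + s • v) v t := by
    simpa using ((hasDerivAt_id t).smul_const v).const_add p
  have h1 : deriv (fun s : ℝ => f (p + s • v)) = fun s => fderiv ℝ f (p + s • v) v := by
    funext t
    exact ((hf.differentiable (by norm_num) _).hasFDerivAt.comp_hasDerivAt t (hline t)).deriv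
  have h2 (t : ℝ) : deriv (fun s : ℝ => fderiv ℝ f (p + s • v) v) t =
      fderiv ℝ (fderiv ℝ f) (p + t • v) v v := by
    have hd : Differentiable ℝ (fderiv ℝ f) :=
      (hf.fderiv_right (m := 2) (by norm_num)).differentiable (by norm_num)
    have h := (hd _).hasFDerivAt.comp_hasDerivAt t (hline t)
    simpa using (h.clm_apply (hasDerivAt_const t v)).deriv
  have hg : ContDiff ℝ (3 : ℕ) fun s : ℝ => f (p + s • v) :=
    hf.comp (contDiff_const.add (contDiff_id.smul contDiff_const))
  have hT := (taylor_isLittleO_univ (x₀ := 0) hg).isBigO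
  have hc : (fun ε : ℝ => (iteratedDeriv 3 (fun s : ℝ => f (p + s • v)) 0 / 6) * ε ^ 3)
      =O[𝓝 0] fun ε => ε ^ 3 := isBigO_const_mul_self _ _ _
  simp only [sub_zero] at hT
  refine (hT.add hc).congr_left fun ε => ?_
  have i2 : iteratedDeriv 2 (fun s : ℝ => f (p + s • v)) 0 =
      fderiv ℝ (fderiv ℝ f) p v v := by
    rw [iteratedDeriv_succ, iteratedDeriv_one, h1, h2]
    simp
  simp only [taylor_within_apply, Finset.sum_range_succ, Finset.sum_range_zero,
    iteratedDerivWithin_univ, iteratedDeriv_zero, iteratedDeriv_one, i2, h1]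
  norm_num [Nat.factorial]
  ring

/-- A `3×3` filter whose moments satisfy `m_{0,0} = 0`, `m_{0,1} = 0`, `m_{0,2} = 0`, `m_{1,0} = 1`, `m_{1,1} = 0`, `m_{2,0} = 0`
approximates `∂/∂x` with second order accuracy: for smooth `f` and every `(x,y)`,
`(1/ε) ∑_{k₁,k₂=-1}^{1} q[k₁,k₂] f(x+k₁ε, y+k₂ε) = ∂f/∂x (x,y) + O(ε²)` as `ε → 0⁺`. -/
theorem filter_second_order_dx_approximation
    (q : ℤ → ℤ → ℝ)
    (h00 : moment3 q 0 0 = 0) (h01 : moment3 q 0 1 = 0) (h02 : moment3 q 0 2 = 0)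
    (h10 : moment3 q 1 0 = 1) (h11 : moment3 q 1 1 = 0) (h20 : moment3 q 2 0 = 0)
    (f : ℝ × ℝ → ℝ) (hf : ContDiff ℝ (⊤ : ℕ∞) f) (x y : ℝ) :
    (fun ε : ℝ =>
      (∑ k₁ ∈ Finset.Icc (-1 : ℤ) 1, ∑ k₂ ∈ Finset.Icc (-1 : ℤ) 1,
        q k₁ k₂ * f (x + (k₁ : ℝ) * ε, y + (k₂ : ℝ) * ε)) / ε
        - deriv (fun s => f (s, y)) x)
    =O[𝓝[>] (0 : ℝ)] (fun ε => ε ^ 2) := by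
  have hf3 : ContDiff ℝ 3 f := contDiff_infty.1 hf 3
  have hR (k₁ k₂ : ℤ) :=
    hf3.isBigO_sub_taylor_two_along_line (x, y) ((k₁ : ℝ), (k₂ : ℝ))
  have hS := IsBigO.sum (s := Finset.Icc (-1 : ℤ) 1) fun k₁ _ =>
    IsBigO.sum (s := Finset.Icc (-1 : ℤ) 1) fun k₂ _ => (hR k₁ k₂).const_mul_left (q k₁ k₂)
  have hD := (hS.mono (nhdsWithin_le_nhds (s := Set.Ioi 0))).mul
    (isBigO_refl (fun ε : ℝ => ε⁻¹) (𝓝[>] 0))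
  have hderiv : deriv (fun s => f (s, y)) x = fderiv ℝ f (x, y) (1, 0) :=
    ((hf.differentiable (by simp) _).hasFDerivAt.comp_hasDerivAt x
      ((hasDerivAt_id x).prodMk (hasDerivAt_const x y))).deriv
  refine hD.congr' ?_ ?_
  · filter_upwards [self_mem_nhdsWithin] with ε hε
    have hε0 : ε ≠ 0 := ne_of_gt hε
    have hvec (a b : ℝ) : ((a, b) : ℝ × ℝ) = a • (1, 0) + b • (0, 1) := by simp
    have hI : Finset.Icc (-1 : ℤ) 1 = {-1, 0, 1} := by decide
    rw [hderiv, eq_sub_iff_add_eq, eq_div_iff hε0, add_mul, mul_assoc, inv_mul_cancel₀ hε0]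
    obtain ⟨L₁, L₂, hL₁, hL⟩ : ∃ L₁ L₂ : ℝ, fderiv ℝ f (x, y) (1, 0) = L₁ ∧
        ∀ a b : ℝ, fderiv ℝ f (x, y) (a, b) = a * L₁ + b * L₂ := by
      refine ⟨_, fderiv ℝ f (x, y) (0, 1), rfl, fun a b => ?_⟩
      rw [hvec a b, map_add, map_smul, map_smul, smul_eq_mul, smul_eq_mul]
    obtain ⟨B₁, B₂, B₃, hB⟩ : ∃ B₁ B₂ B₃ : ℝ, ∀ a b : ℝ,
        fderiv ℝ (fderiv ℝ f) (x, y) (a, b) (a, b) =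
          a ^ 2 * B₁ + a * b * B₂ + b ^ 2 * B₃ := by
      refine ⟨fderiv ℝ (fderiv ℝ f) (x, y) (1, 0) (1, 0),
        fderiv ℝ (fderiv ℝ f) (x, y) (1, 0) (0, 1) +
          fderiv ℝ (fderiv ℝ f) (x, y) (0, 1) (1, 0),
        fderiv ℝ (fderiv ℝ f) (x, y) (0, 1) (0, 1), fun a b => ?_⟩
      rw [hvec a b]
      simp only [map_add, map_smul, add_apply, smul_apply, smul_eq_mul]
      ring
    rw [hL₁]
    simp only [hL, hB]
    simp only [moment3, hI] at h00 h01 h02 h10 h11 h20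
    simp [Nat.factorial] at h00 h01 h02 h10 h11 h20
    simp [hI]
    linear_combination (-f (x, y)) * h00 - ε * L₁ * h10 - ε * L₂ * h01 -
      ε ^ 2 / 2 * B₁ * h20 - ε ^ 2 / 2 * B₂ * h11 - ε ^ 2 / 2 * B₃ * h02
  · filter_upwards [self_mem_nhdsWithin] with ε hε
    have hε0 : ε ≠ 0 := ne_of_gt hε
    field_simp
end
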